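/- Let τ > 0 and ω > 0. The delay cosine x(t) := cos_τ(ω,t) solves the linear homogeneous second-order delay differential equation with pure delay subject to unit initial conditions: x(t) = 1 for all t ∈ [-τ, 0), and x is twice differentiable at every t ∈ (0, ∞) with x''(t) + ω² x(t - τ) = 0 for all t ∈ (0, ∞). -/

import Mathlib

open Real Set Filter Topology MeasureTheory

/-- `C` is the delay cosine function `cos_τ(ω, ·)`: it vanishes for `t < -τ` and, for every
integer `k ≥ 0` and `(k-1)τ ≤ t < kτ`, equals
`∑_{j=0}^{k} (-1)^j ω^(2j) (t-(j-1)τ)^(2j) / (2j)!`. -/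
def IsDelayCos (τ ω : ℝ) (C : ℝ → ℝ) : Prop :=
  (∀ t : ℝ, t < -τ → C t = 0) ∧
  ∀ (k : ℕ) (t : ℝ), ((k : ℝ) - 1) * τ ≤ t → t < (k : ℝ) * τ →
    C t = ∑ j ∈ Finset.range (k + 1),
      (-1 : ℝ) ^ j * ω ^ (2 * j) * (t - ((j : ℝ) - 1) * τ) ^ (2 * j) / ((2 * j).factorial : ℝ)

/-- `S` is the delay sine function `sin_τ(ω, ·)`: it vanishes for `t < -τ` and, for every
integer `k ≥ 0` and `(k-1)τ ≤ t < kτ`, equals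
`∑_{j=0}^{k} (-1)^j ω^(2j+1) (t-(j-1)τ)^(2j+1) / (2j+1)!`. -/
def IsDelaySin (τ ω : ℝ) (S : ℝ → ℝ) : Prop :=
  (∀ t : ℝ, t < -τ → S t = 0) ∧
  ∀ (k : ℕ) (t : ℝ), ((k : ℝ) - 1) * τ ≤ t → t < (k : ℝ) * τ →
    S t = ∑ j ∈ Finset.range (k + 1),
      (-1 : ℝ) ^ j * ω ^ (2 * j + 1) * (t - ((j : ℝ) - 1) * τ) ^ (2 * j + 1) / ((2 * j + 1).factorial : ℝ)

/-- Truncated powers `s₊ ^ (n + 1)` are differentiable on the positive half-line, and everywhere if `n ≠ 0`. -/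
theorem hasDerivAt_max_zero_pow (n : ℕ) (s : ℝ) (h : 0 < s ∨ n ≠ 0) :
    HasDerivAt (fun u : ℝ => max u 0 ^ (n + 1)) ((n + 1 : ℝ) * max s 0 ^ n) s := by
  have hpow : HasDerivAt (fun u : ℝ => u ^ (n + 1)) ((n + 1 : ℝ) * s ^ n) s := by
    simpa using hasDerivAt_pow (n + 1) s
  rcases lt_trichotomy s 0 with hs | rfl | hs
  · have hn : n ≠ 0 := h.resolve_left hs.not_gt
    rw [max_eq_right hs.le, zero_pow hn, mul_zero]
    refine (hasDerivAt_const s (0 : ℝ)).congr_of_eventuallyEq ?_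
    filter_upwards [Iio_mem_nhds hs] with u hu
    simp [max_eq_right (le_of_lt (show u < 0 from hu))]
  · have hn : n ≠ 0 := by simpa using h
    have hleft : HasDerivWithinAt (fun u : ℝ => max u 0 ^ (n + 1)) 0 (Iic 0) 0 :=
      (hasDerivWithinAt_const (0 : ℝ) (Iic 0) (0 : ℝ)).congr
        (fun u hu => by simp [max_eq_right (show u ≤ 0 from hu)]) (by simp)
    have hright : HasDerivWithinAt (fun u : ℝ => max u 0 ^ (n + 1)) 0 (Ici 0) 0 := by
      refine HasDerivWithinAt.congr (f := fun u : ℝ => u ^ (n + 1)) ?_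
        (fun u hu => by rw [max_eq_left (show 0 ≤ u from hu)]) (by simp)
      simpa [hn] using hpow.hasDerivWithinAt (s := Ici 0)
    simpa [hn, Iic_union_Ici] using hleft.union hright
  · rw [max_eq_left hs.le]
    refine hpow.congr_of_eventuallyEq ?_
    filter_upwards [Ioi_mem_nhds hs] with u hu
    rw [max_eq_left (le_of_lt (show 0 < u from hu))]

/-- On `[-τ, Nτ)` the delay cosine is a single sum of truncated powers. -/
theorem IsDelayCos.eq_sum_max {τ ω : ℝ} {C : ℝ → ℝ} (hC : IsDelayCos τ ω C) (hτ : 0 < τ)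
    (N : ℕ) (t : ℝ) (h₁ : -τ ≤ t) (h₂ : t < N * τ) :
    C t = ∑ j ∈ Finset.range (N + 1),
      (-1 : ℝ) ^ j * ω ^ (2 * j) * max (t - ((j : ℝ) - 1) * τ) 0 ^ (2 * j) /
        ((2 * j).factorial : ℝ) := by
  induction N with
  | zero => simpa using hC.2 0 t (by simpa using h₁) h₂
  | succ N ih =>
    rcases lt_or_ge t (N * τ) with h | h
    · rw [Finset.sum_range_succ, ← ih h]
      have : t - (((N + 1 : ℕ) : ℝ) - 1) * τ ≤ 0 := by push_cast; linarith
      rw [max_eq_right this]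
      simp
    · rw [hC.2 (N + 1) t (by push_cast; linarith) h₂]
      refine Finset.sum_congr rfl fun j hj => ?_
      have hj : (j : ℝ) ≤ N + 1 := by
        exact_mod_cast Nat.lt_succ_iff.mp (Finset.mem_range.mp hj)
      rw [max_eq_left (by nlinarith)]

/-- The derivative of a truncated power with corner at `a`. -/
theorem hasDerivAt_max_sub_pow (n : ℕ) (a t : ℝ) (h : a < t ∨ n ≠ 0) :
    HasDerivAt (fun u : ℝ => max (u - a) 0 ^ (n + 1)) ((n + 1 : ℝ) * max (t - a) 0 ^ n) t := by
  simpa using (hasDerivAt_max_zero_pow n (t - a) (h.imp_left sub_pos.mpr)).comp_sub_const t a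

/-- On `(0, Nτ)` the derivative of the delay cosine is a sum of truncated odd powers. -/
theorem IsDelayCos.hasDerivAt {τ ω : ℝ} {C : ℝ → ℝ} (hC : IsDelayCos τ ω C) (hτ : 0 < τ)
    (N : ℕ) (t : ℝ) (h₁ : 0 < t) (h₂ : t < N * τ) :
    HasDerivAt C (∑ i ∈ Finset.range N, (-1 : ℝ) ^ (i + 1) * ω ^ (2 * (i + 1)) *
      max (t - i * τ) 0 ^ (2 * i + 1) / ((2 * i + 1).factorial : ℝ)) t := by
  have heq : C =ᶠ[𝓝 t] fun u => (∑ i ∈ Finset.range N, (-1 : ℝ) ^ (i + 1) * ω ^ (2 * (i + 1)) /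
      ((2 * (i + 1)).factorial : ℝ) * max (u - i * τ) 0 ^ (2 * i + 1 + 1)) + 1 := by
    filter_upwards [Ioo_mem_nhds h₁ h₂] with u hu
    rw [hC.eq_sum_max hτ N u (by linarith [hu.1]) hu.2, Finset.sum_range_succ']
    congr 1
    · refine Finset.sum_congr rfl fun i _ => ?_
      push_cast
      rw [add_sub_cancel_right, show 2 * (i + 1) = 2 * i + 1 + 1 by ring]
      ring
    · simp
  refine HasDerivAt.congr_of_eventuallyEq ?_ heq
  refine HasDerivAt.add_const _ (HasDerivAt.fun_sum fun i _ => ?_)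
  refine ((hasDerivAt_max_sub_pow (2 * i + 1) (i * τ) t (by simp)).const_mul _).congr_deriv ?_
  rw [show 2 * (i + 1) = 2 * i + 1 + 1 by ring, Nat.factorial_succ]
  push_cast
  field_simp

/-- **The delay cosine solves the pure-delay oscillator with unit initial data**
(`τ > 0`, `ω > 0`): `x = cos_τ(ω,·)` satisfies `x(t) = 1` on `[-τ, 0)` and is twice
differentiable at every `t ∈ (0, ∞)` with `x''(t) + ω² x(t - τ) = 0` there. -/
theorem delay_cos_solves_ivp (τ ω : ℝ) (hτ : 0 < τ) (hω : 0 < ω)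
    (dc : ℝ → ℝ) (hc : IsDelayCos τ ω dc) :
    (∀ t ∈ Set.Ico (-τ) (0 : ℝ), dc t = 1) ∧
    ∃ dc' : ℝ → ℝ,
      (∀ t ∈ Set.Ioi (0 : ℝ), HasDerivAt dc (dc' t) t) ∧
      ∀ t ∈ Set.Ioi (0 : ℝ), HasDerivAt dc' (-(ω ^ 2 * dc (t - τ))) t := by
  refine ⟨fun t ht => by simpa using hc.2 0 t (by simpa using ht.1) (by simpa using ht.2),
    deriv dc, fun t ht => ?_, fun t ht => ?_⟩
  all_goals
    obtain ⟨N, hN⟩ := exists_nat_gt (t / τ)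
    have ht : 0 < t := ht
    have htN : t < (N + 1 : ℕ) * τ := by
      rw [div_lt_iff₀ hτ] at hN
      push_cast
      linarith
  · exact (hc.hasDerivAt hτ (N + 1) t ht htN).differentiableAt.hasDerivAt
  · have heq : deriv dc =ᶠ[𝓝 t] fun u => ∑ i ∈ Finset.range (N + 1),
        (-1 : ℝ) ^ (i + 1) * ω ^ (2 * (i + 1)) / ((2 * i + 1).factorial : ℝ) *
          max (u - i * τ) 0 ^ (2 * i + 1) := by
      filter_upwards [Ioo_mem_nhds ht htN] with u hu
      rw [(hc.hasDerivAt hτ (N + 1) u hu.1 hu.2).deriv]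
      exact Finset.sum_congr rfl fun i _ => by ring
    refine HasDerivAt.congr_of_eventuallyEq ?_ heq
    rw [hc.eq_sum_max hτ N (t - τ) (by linarith) (by push_cast at htN; linarith),
      Finset.mul_sum, ← Finset.sum_neg_distrib]
    refine HasDerivAt.fun_sum fun i _ => ?_
    have hi : i * τ < t ∨ 2 * i ≠ 0 := by
      rcases eq_or_ne i 0 with rfl | hi
      · left; simpa using ht
      · right; simpa using hi
    refine ((hasDerivAt_max_sub_pow (2 * i) (i * τ) t hi).const_mul _).congr_deriv ?_
    rw [show t - τ - ((i : ℝ) - 1) * τ = t - i * τ by ring, Nat.factorial_succ]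
    push_cast
    field_simp
    ring
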